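/- arXiv:0805.0732 — 4 statements merged into one kernel-verified Lean document; each statement's English description precedes it below -/
import Mathlib

section
/- Let n ≥ 1, let T be a symmetric positive definite real n×n matrix, let S be an invertible real n×n matrix with S Sᵀ = T⁻¹, and let A be a real symmetric n×n matrix with R = Sᵀ A S. Let f : ℝ → ℝ be a nonnegative measurable function with ∫_{ℝⁿ} (1+‖w‖⁴) f(‖w‖²) dw < ∞, and for indices a,b,k,l set D^{ab}_{kl} = ∫_{ℝⁿ} w_a w_b w_k w_l f(‖w‖²) dw. Then for all i, j, ∫_{ℝⁿ} v_i v_j (vᵀ A v) f(vᵀ T v) dv = (det T)^{-1/2} · (S M Sᵀ)_{ij}, where M is the n×n matrix with entries M_{ab} = Σ_{k,l} R_{kl} D^{ab}_{kl}. -/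
open MeasureTheory Matrix Real

lemma aux_integrable (n : ℕ) (f : ℝ → ℝ) (hfm : Measurable f) (hf0 : ∀ t, 0 ≤ f t)
    (hfint : Integrable (fun w : EuclideanSpace ℝ (Fin n) => (1 + ‖w‖ ^ 4) * f (‖w‖ ^ 2)))
    (a b k l : Fin n) :
    Integrable (fun w : EuclideanSpace ℝ (Fin n) => w a * w b * w k * w l * f (‖w‖ ^ 2)) := by
  refine hfint.mono' ?_ ?_
  · apply Measurable.aestronglyMeasurable
    have h : Measurable (fun w : EuclideanSpace ℝ (Fin n) => f (‖w‖ ^ 2)) :=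
      hfm.comp (by fun_prop)
    have h2 : Measurable (fun w : EuclideanSpace ℝ (Fin n) => w a * w b * w k * w l) :=
      Continuous.measurable (by fun_prop)
    exact h2.mul h
  · refine Filter.Eventually.of_forall fun w => ?_
    have hc : ∀ i : Fin n, |w i| ≤ ‖w‖ := fun i => by
      simpa using PiLp.norm_apply_le w i
    rw [norm_mul, Real.norm_of_nonneg (hf0 _)]
    refine mul_le_mul_of_nonneg_right ?_ (hf0 _)
    rw [Real.norm_eq_abs, abs_mul, abs_mul, abs_mul]
    calc |w a| * |w b| * |w k| * |w l| ≤ ‖w‖ * ‖w‖ * ‖w‖ * ‖w‖ := by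
          gcongr <;> apply hc
      _ ≤ 1 + ‖w‖ ^ 4 := by nlinarith

lemma aux_cov (n : ℕ) (S : Matrix (Fin n) (Fin n) ℝ) (hS : IsUnit S.det)
    (g : EuclideanSpace ℝ (Fin n) → ℝ) :
    ∫ v, g v = |S.det| * ∫ w : EuclideanSpace ℝ (Fin n), g (WithLp.toLp 2 (S *ᵥ w.ofLp)) := by
  have hL : ∀ w, (Matrix.toEuclideanCLM (𝕜 := ℝ) S) w = WithLp.toLp 2 (S *ᵥ w.ofLp) := fun w => by
    apply WithLp.ofLp_injective 2
    rw [Matrix.ofLp_toEuclideanCLM]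
  have hdet : (Matrix.toEuclideanCLM (𝕜 := ℝ) S).det = S.det := by
    rw [ContinuousLinearMap.det, Matrix.coe_toEuclideanCLM_eq_toEuclideanLin]
    exact LinearMap.det_toLpLin 2 S
  have hu := (Matrix.isUnit_iff_isUnit_det S).2 hS
  have hinj : Function.Injective (Matrix.toEuclideanCLM (𝕜 := ℝ) S) := by
    intro x y h
    rw [hL, hL] at h
    have := Matrix.mulVec_injective_of_isUnit hu (congrArg WithLp.ofLp h)
    exact (WithLp.ofLp_injective 2) this
  have hsurj : Function.Surjective (Matrix.toEuclideanCLM (𝕜 := ℝ) S) := by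
    intro y
    obtain ⟨x, hx⟩ := (Matrix.mulVec_surjective_iff_isUnit.2 hu) y.ofLp
    exact ⟨WithLp.toLp 2 x, by rw [hL, WithLp.ofLp_toLp, hx]⟩
  have := integral_image_eq_integral_abs_det_fderiv_smul (volume : Measure (EuclideanSpace ℝ (Fin n)))
    MeasurableSet.univ (f := Matrix.toEuclideanCLM (𝕜 := ℝ) S)
    (f' := fun _ => Matrix.toEuclideanCLM (𝕜 := ℝ) S)
    (fun x _ => (ContinuousLinearMap.hasFDerivAt _).hasFDerivWithinAt) hinj.injOn g
  rw [Set.image_univ, hsurj.range_eq, setIntegral_univ, setIntegral_univ, hdet] at this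
  rw [this]
  simp only [smul_eq_mul, hL]
  rw [integral_const_mul]

theorem stmt_3 (n : ℕ) (hn : 1 ≤ n)
    (T S A : Matrix (Fin n) (Fin n) ℝ)
    (hTsymm : T.IsSymm) (hTpd : T.PosDef)
    (hS : IsUnit S.det)
    (hST : S * Sᵀ = T⁻¹)
    (hAsymm : A.IsSymm)
    (R : Matrix (Fin n) (Fin n) ℝ) (hR : R = Sᵀ * A * S)
    (f : ℝ → ℝ) (hfm : Measurable f) (hf0 : ∀ t, 0 ≤ f t)
    (hfint : Integrable (fun w : EuclideanSpace ℝ (Fin n) => (1 + ‖w‖ ^ 4) * f (‖w‖ ^ 2)))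
    (D : Fin n → Fin n → Fin n → Fin n → ℝ)
    (hD : ∀ a b k l, D a b k l = ∫ w : EuclideanSpace ℝ (Fin n), w a * w b * w k * w l * f (‖w‖ ^ 2))
    (M : Matrix (Fin n) (Fin n) ℝ)
    (hM : ∀ a b, M a b = ∑ k, ∑ l, R k l * D a b k l) :
    ∀ i j : Fin n,
      (∫ v : EuclideanSpace ℝ (Fin n), v i * v j * (v ⬝ᵥ A.mulVec v) * f (v ⬝ᵥ T.mulVec v)) =
        T.det ^ (-(1 : ℝ) / 2) * (S * M * Sᵀ) i j := by
  intro i j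
  have hTdet : 0 < T.det := hTpd.det_pos
  have hTu : IsUnit T.det := hTdet.ne'.isUnit
  have hone : Sᵀ * T * S = 1 := by
    rw [mul_eq_one_comm, ← Matrix.mul_assoc, hST, Matrix.nonsing_inv_mul _ hTu]
  have hd : |S.det| = T.det ^ (-(1 : ℝ) / 2) := by
    have h := congrArg Matrix.det hone
    rw [det_mul, det_mul, det_transpose, det_one] at h
    have h2 : S.det ^ 2 = T.det⁻¹ := by
      field_simp
      linarith
    rw [← Real.sqrt_sq_eq_abs, h2, Real.sqrt_eq_rpow, Real.inv_rpow hTdet.le, ← Real.rpow_neg hTdet.le]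
    norm_num
  have hquad : ∀ (B : Matrix (Fin n) (Fin n) ℝ) (w : Fin n → ℝ),
      (S *ᵥ w) ⬝ᵥ (B *ᵥ (S *ᵥ w)) = w ⬝ᵥ ((Sᵀ * B * S) *ᵥ w) := by
    intro B w
    rw [← Matrix.mulVec_mulVec, ← Matrix.mulVec_mulVec, Matrix.dotProduct_mulVec w,
      Matrix.vecMul_transpose]
  rw [aux_cov n S hS, hd]
  congr 1
  have hpt : ∀ w : EuclideanSpace ℝ (Fin n),
      (S *ᵥ w.ofLp) i * (S *ᵥ w.ofLp) j * ((S *ᵥ w.ofLp) ⬝ᵥ (A *ᵥ (S *ᵥ w.ofLp)))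
        * f ((S *ᵥ w.ofLp) ⬝ᵥ (T *ᵥ (S *ᵥ w.ofLp)))
      = ∑ b, ∑ a, ∑ k, ∑ l, (S i a * S j b * R k l) *
          (w a * w b * w k * w l * f (‖w‖ ^ 2)) := by
    intro w
    have hn2 : w.ofLp ⬝ᵥ w.ofLp = ‖w‖ ^ 2 := by
      rw [EuclideanSpace.real_norm_sq_eq]
      simp [dotProduct, sq]
    rw [hquad, hquad, hone, ← hR, Matrix.one_mulVec, hn2]
    have hre : ∀ x y q z : ℝ, x * y * q * z = y * (x * (q * z)) := fun x y q z => by ring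
    rw [hre]
    simp only [Matrix.mulVec, dotProduct]
    rw [Finset.sum_mul]
    refine Finset.sum_congr rfl fun b _ => ?_
    rw [Finset.sum_mul, Finset.mul_sum]
    refine Finset.sum_congr rfl fun a _ => ?_
    rw [Finset.sum_mul, Finset.mul_sum, Finset.mul_sum]
    refine Finset.sum_congr rfl fun k _ => ?_
    rw [Finset.mul_sum, Finset.sum_mul, Finset.mul_sum, Finset.mul_sum]
    refine Finset.sum_congr rfl fun l _ => ?_
    ring
  simp only [hpt]
  have hint := aux_integrable n f hfm hf0 hfint
  rw [integral_finsetSum _ fun b _ => integrable_finsetSum _ fun a _ => integrable_finsetSum _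
    fun k _ => integrable_finsetSum _ fun l _ => (hint a b k l).const_mul _]
  simp only [Matrix.mul_apply, Finset.sum_mul, hM, Matrix.transpose_apply, Finset.mul_sum, hD]
  refine Finset.sum_congr rfl fun b _ => ?_
  rw [integral_finsetSum _ fun a _ => integrable_finsetSum _
    fun k _ => integrable_finsetSum _ fun l _ => (hint a b k l).const_mul _]
  refine Finset.sum_congr rfl fun a _ => ?_
  rw [integral_finsetSum _ 
    fun k _ => integrable_finsetSum _ fun l _ => (hint a b k l).const_mul _]
  refine Finset.sum_congr rfl fun k _ => ?_
  rw [integral_finsetSum _ fun l _ => (hint a b k l).const_mul _]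
  refine Finset.sum_congr rfl fun l _ => ?_
  rw [integral_const_mul]
  ring
end

section
/- Let n ≥ 1 and σ > 0. Then for all indices i, j, ∫_{ℝⁿ} v_i v_j ‖v‖⁴ exp(−‖v‖²/(2σ²)) dv = δ_{ij} (n+2)(n+4) (2π)^{n/2} σ^{n+6}, where δ_{ij} is the Kronecker delta. -/
open MeasureTheory Real

lemma aux_oneD (m : ℕ) {b : ℝ} (hb : 0 < b) :
    ∫ y in Set.Ioi (0 : ℝ), y ^ m * rexp (-b * y ^ 2) =
      b ^ (-((m : ℝ) + 1) / 2) * (1 / 2) * Real.Gamma (((m : ℝ) + 1) / 2) := by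
  rw [← integral_rpow_mul_exp_neg_mul_rpow two_pos
    (by have : (0 : ℝ) ≤ m := Nat.cast_nonneg m
        linarith) hb]
  simp [Real.rpow_natCast]

lemma aux_ratio (m : ℕ) {b : ℝ} (hb : 0 < b) :
    ∫ y in Set.Ioi (0 : ℝ), y ^ (m + 6) * rexp (-b * y ^ 2) =
      (((m : ℝ) + 1) / 2) * (((m : ℝ) + 3) / 2) * (((m : ℝ) + 5) / 2) * (b ^ 3)⁻¹ *
      ∫ y in Set.Ioi (0 : ℝ), y ^ m * rexp (-b * y ^ 2) := by
  have hm : (0 : ℝ) ≤ m := Nat.cast_nonneg m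
  rw [aux_oneD _ hb, aux_oneD _ hb]
  have e1 : ((((m + 6 : ℕ) : ℝ)) + 1) / 2 = (((m : ℝ) + 1) / 2 + 1 + 1) + 1 := by
    push_cast; ring
  have e2 : -((((m + 6 : ℕ) : ℝ)) + 1) / 2 = -((m : ℝ) + 1) / 2 - ((3 : ℕ) : ℝ) := by
    push_cast; ring
  rw [e1, e2, Real.Gamma_add_one (by positivity), Real.Gamma_add_one (by positivity),
    Real.Gamma_add_one (by positivity), Real.rpow_sub hb, Real.rpow_natCast]
  field_simp
  ring

lemma aux_radial_int (n : ℕ) (hn : 1 ≤ n) {b : ℝ} (hb : 0 < b) :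
    Integrable (fun v : EuclideanSpace ℝ (Fin n) => ‖v‖ ^ 6 * rexp (-b * ‖v‖ ^ 2)) := by
  haveI : Nonempty (Fin n) := ⟨⟨0, hn⟩⟩
  refine (integrable_fun_norm_addHaar (volume : Measure (EuclideanSpace ℝ (Fin n)))
    (f := fun y => y ^ 6 * rexp (-b * y ^ 2))).2 ?_
  have h := integrableOn_rpow_mul_exp_neg_mul_sq hb (s := ((n - 1 + 6 : ℕ) : ℝ))
    (by have : (0 : ℝ) ≤ ((n - 1 + 6 : ℕ) : ℝ) := Nat.cast_nonneg _
        linarith)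
  simp only [Real.rpow_natCast] at h
  simpa [pow_add, mul_assoc] using h

lemma aux_radial (n : ℕ) (hn : 1 ≤ n) {b : ℝ} (hb : 0 < b) :
    ∫ v : EuclideanSpace ℝ (Fin n), ‖v‖ ^ 6 * rexp (-b * ‖v‖ ^ 2) =
      ((n : ℝ) / 2) * (((n : ℝ) + 2) / 2) * (((n : ℝ) + 4) / 2) * (b ^ 3)⁻¹ *
        (π / b) ^ ((n : ℝ) / 2) := by
  haveI : Nonempty (Fin n) := ⟨⟨0, hn⟩⟩
  have h0 := GaussianFourier.integral_rexp_neg_mul_sq_norm (V := EuclideanSpace ℝ (Fin n)) hb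
  rw [integral_fun_norm_addHaar volume (fun y => rexp (-b * y ^ 2))] at h0
  rw [integral_fun_norm_addHaar volume (fun y => y ^ 6 * rexp (-b * y ^ 2))]
  obtain ⟨m, rfl⟩ : ∃ m, n = m + 1 := ⟨n - 1, by omega⟩
  have hr := aux_ratio m hb
  simp only [finrank_euclideanSpace, Fintype.card_fin, Nat.add_sub_cancel, smul_eq_mul,
    nsmul_eq_mul, ← mul_assoc, ← pow_add] at h0 ⊢
  rw [hr, ← h0]
  push_cast
  ring

lemma aux_diag (n : ℕ) (hn : 1 ≤ n) {b : ℝ} (hb : 0 < b) (i : Fin n) :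
    (n : ℝ) * ∫ v : EuclideanSpace ℝ (Fin n), v i * v i * ‖v‖ ^ 4 * rexp (-b * ‖v‖ ^ 2) =
      ∫ v : EuclideanSpace ℝ (Fin n), ‖v‖ ^ 6 * rexp (-b * ‖v‖ ^ 2) := by
  have hsym : ∀ k : Fin n,
      ∫ v : EuclideanSpace ℝ (Fin n), v k * v k * ‖v‖ ^ 4 * rexp (-b * ‖v‖ ^ 2) =
      ∫ v : EuclideanSpace ℝ (Fin n), v i * v i * ‖v‖ ^ 4 * rexp (-b * ‖v‖ ^ 2) := by
    intro k
    let e := LinearIsometryEquiv.piLpCongrLeft 2 ℝ ℝ (Equiv.swap i k)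
    rw [← (LinearIsometryEquiv.measurePreserving e).integral_comp
      e.toHomeomorph.measurableEmbedding]
    have hk : ∀ v : EuclideanSpace ℝ (Fin n), (e v) k = v i := by
      intro v
      simp [e, LinearIsometryEquiv.piLpCongrLeft_apply]
    simp only [hk, LinearIsometryEquiv.norm_map]
  have hint : ∀ k : Fin n, Integrable (fun v : EuclideanSpace ℝ (Fin n) =>
      v k * v k * ‖v‖ ^ 4 * rexp (-b * ‖v‖ ^ 2)) := by
    intro k
    refine (aux_radial_int n hn hb).mono' (by fun_prop) (Filter.Eventually.of_forall fun v => ?_)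
    have h1 : |v k| ≤ ‖v‖ := by simpa using PiLp.norm_apply_le v k
    rw [Real.norm_eq_abs, abs_of_nonneg (by positivity [mul_self_nonneg (v k)])]
    have h2 : v k * v k ≤ ‖v‖ ^ 2 := by
      rw [← abs_mul_abs_self, sq]; gcongr
    calc v k * v k * ‖v‖ ^ 4 * rexp (-b * ‖v‖ ^ 2)
        ≤ ‖v‖ ^ 2 * ‖v‖ ^ 4 * rexp (-b * ‖v‖ ^ 2) := by gcongr
      _ = _ := by ring
  have hs : ∀ v : EuclideanSpace ℝ (Fin n), ‖v‖ ^ 6 * rexp (-b * ‖v‖ ^ 2) =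
      ∑ k, v k * v k * ‖v‖ ^ 4 * rexp (-b * ‖v‖ ^ 2) := by
    intro v
    rw [← Finset.sum_mul, ← Finset.sum_mul]
    have : ∑ k, v k * v k = ‖v‖ ^ 2 := by
      rw [EuclideanSpace.real_norm_sq_eq]
      simp [sq]
    rw [this]; ring
  simp_rw [hs]
  rw [integral_finset_sum _ (fun k _ => hint k), Finset.sum_congr rfl (fun k _ => hsym k)]
  simp

lemma aux_off (n : ℕ) {b : ℝ} (i j : Fin n) (hij : i ≠ j) :
    ∫ v : EuclideanSpace ℝ (Fin n), v i * v j * ‖v‖ ^ 4 * rexp (-b * ‖v‖ ^ 2) = 0 := by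
  let e : EuclideanSpace ℝ (Fin n) ≃ₗᵢ[ℝ] EuclideanSpace ℝ (Fin n) :=
    LinearIsometryEquiv.piLpCongrRight 2
      (fun k => if k = i then LinearIsometryEquiv.neg ℝ else LinearIsometryEquiv.refl ℝ ℝ)
  have h := (LinearIsometryEquiv.measurePreserving e).integral_comp
      e.toHomeomorph.measurableEmbedding
      (fun v => v i * v j * ‖v‖ ^ 4 * rexp (-b * ‖v‖ ^ 2))
  have hi : ∀ v : EuclideanSpace ℝ (Fin n), (e v) i = - v i := by
    intro v; simp [e]
  have hj : ∀ v : EuclideanSpace ℝ (Fin n), (e v) j = v j := by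
    intro v; simp [e, hij.symm]
  simp only [hi, hj, LinearIsometryEquiv.norm_map, neg_mul, integral_neg] at h
  simp only [neg_mul]
  linarith

theorem stmt_10 (n : ℕ) (hn : 1 ≤ n) (σ : ℝ) (hσ : 0 < σ) :
    ∀ i j : Fin n,
      (∫ v : EuclideanSpace ℝ (Fin n),
          v i * v j * ‖v‖ ^ 4 * Real.exp (-‖v‖ ^ 2 / (2 * σ ^ 2))) =
        (if i = j then 1 else 0) * (n + 2) * (n + 4) *
          (2 * Real.pi) ^ ((n : ℝ) / 2) * σ ^ (n + 6) := by
  intro i j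
  have hb : 0 < (2 * σ ^ 2)⁻¹ := by positivity
  have he : ∀ v : EuclideanSpace ℝ (Fin n),
      -‖v‖ ^ 2 / (2 * σ ^ 2) = -(2 * σ ^ 2)⁻¹ * ‖v‖ ^ 2 := by
    intro v; rw [div_eq_mul_inv]; ring
  simp_rw [he]
  by_cases hij : i = j
  · subst hij
    have h := aux_diag n hn hb i
    rw [aux_radial n hn hb] at h
    have hp : (π / (2 * σ ^ 2)⁻¹) ^ ((n : ℝ) / 2) = (2 * π) ^ ((n : ℝ) / 2) * σ ^ n := by
      rw [show π / (2 * σ ^ 2)⁻¹ = (2 * π) * σ ^ 2 by rw [div_inv_eq_mul]; ring,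
        Real.mul_rpow (by positivity) (by positivity), ← Real.rpow_natCast σ 2,
        ← Real.rpow_mul hσ.le, ← Real.rpow_natCast σ n]
      congr 2
      push_cast; ring
    rw [hp] at h
    have hn0 : (n : ℝ) ≠ 0 := by positivity
    apply mul_left_cancel₀ hn0
    rw [h, if_pos rfl, inv_pow, inv_inv]
    ring
  · rw [aux_off n i j hij, if_neg hij]; ring
end

section
/- Let n ≥ 1 and σ > 0. Then for all indices i, j, ∫_{ℝⁿ} v_i v_j (1 − ‖v‖²/6 + ‖v‖⁴/120) exp(−‖v‖²/(2σ²)) dv = δ_{ij} (2π)^{n/2} σ^{n+2} (1 − ((n+2)/6)σ² + ((n+2)(n+4)/120)σ⁴), where δ_{ij} is the Kronecker delta. -/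
open MeasureTheory Real

lemma radial_one {n : ℕ} (b : ℝ) (k : ℕ) (y : ℝ) (hn : 1 ≤ n) :
    y ^ (n - 1) • (y ^ k * Real.exp (-b * y ^ 2)) =
      y ^ ((n : ℝ) - 1 + k) * Real.exp (-b * y ^ (2 : ℝ)) := by
  have : ((n : ℝ) - 1 + k) = ((n - 1 + k : ℕ) : ℝ) := by
    push_cast [Nat.cast_sub hn]; ring
  rw [this, Real.rpow_natCast, Real.rpow_two, smul_eq_mul, pow_add]
  ring

lemma moment_integrable {n : ℕ} (hn : 1 ≤ n) {b : ℝ} (hb : 0 < b) (k : ℕ) :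
    Integrable (fun v : EuclideanSpace ℝ (Fin n) => ‖v‖ ^ k * Real.exp (-b * ‖v‖ ^ 2)) := by
  have : Nonempty (Fin n) := ⟨⟨0, hn⟩⟩
  have h := (integrable_fun_norm_addHaar (E := EuclideanSpace ℝ (Fin n)) volume
    (f := fun y : ℝ => y ^ k * Real.exp (-b * y ^ 2))).2
  apply h
  rw [finrank_euclideanSpace_fin]
  simp_rw [radial_one b k _ hn]
  have hn' : (1 : ℝ) ≤ n := by exact_mod_cast hn
  have hk : (0 : ℝ) ≤ k := by positivity
  exact integrableOn_rpow_mul_exp_neg_mul_rpow (by linarith) two_pos hb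

lemma moment_succ {n : ℕ} (hn : 1 ≤ n) {b : ℝ} (hb : 0 < b) (k : ℕ) :
    (∫ v : EuclideanSpace ℝ (Fin n), ‖v‖ ^ (k + 2) * Real.exp (-b * ‖v‖ ^ 2)) =
      ((n : ℝ) + k) / (2 * b) *
        ∫ v : EuclideanSpace ℝ (Fin n), ‖v‖ ^ k * Real.exp (-b * ‖v‖ ^ 2) := by
  have : Nonempty (Fin n) := ⟨⟨0, hn⟩⟩
  have h := fun k : ℕ => integral_fun_norm_addHaar (E := EuclideanSpace ℝ (Fin n)) volume
    (fun y : ℝ => y ^ k * Real.exp (-b * y ^ 2))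
  have hn' : (1 : ℝ) ≤ n := by exact_mod_cast hn
  have hk : (0 : ℝ) ≤ k := by positivity
  rw [h, h, finrank_euclideanSpace_fin]
  simp_rw [radial_one b _ _ hn]
  rw [integral_rpow_mul_exp_neg_mul_rpow two_pos (by push_cast; linarith) hb,
    integral_rpow_mul_exp_neg_mul_rpow two_pos (by linarith) hb]
  have e1 : ((n : ℝ) - 1 + ((k + 2 : ℕ) : ℝ) + 1) / 2 = ((n : ℝ) - 1 + k + 1) / 2 + 1 := by
    push_cast; ring
  have e2 : -((n : ℝ) - 1 + ((k + 2 : ℕ) : ℝ) + 1) / 2 = -((n : ℝ) - 1 + k + 1) / 2 - 1 := by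
    push_cast; ring
  rw [e1, e2, Real.Gamma_add_one (by intro h0; linarith), Real.rpow_sub_one hb.ne']
  simp only [nsmul_eq_mul, smul_eq_mul]
  field_simp
  ring

lemma diag_eq {n : ℕ} (g : ℝ → ℝ) (i j : Fin n) :
    (∫ v : EuclideanSpace ℝ (Fin n), v i * v i * g ‖v‖) =
      ∫ v : EuclideanSpace ℝ (Fin n), v j * v j * g ‖v‖ := by
  let e := LinearIsometryEquiv.piLpCongrLeft 2 ℝ ℝ (Equiv.swap i j)
  have := e.measurePreserving.integral_comp e.toHomeomorph.measurableEmbedding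
    (fun v : EuclideanSpace ℝ (Fin n) => v i * v i * g ‖v‖)
  rw [← this]
  congr 1
  ext v
  have h1 : (e v) i = v j := by
    simp [e, LinearIsometryEquiv.piLpCongrLeft_apply]
  rw [h1, LinearIsometryEquiv.norm_map]

lemma offdiag_zero {n : ℕ} (g : ℝ → ℝ) (i j : Fin n) (hij : i ≠ j) :
    (∫ v : EuclideanSpace ℝ (Fin n), v i * v j * g ‖v‖) = 0 := by
  let e : EuclideanSpace ℝ (Fin n) ≃ₗᵢ[ℝ] EuclideanSpace ℝ (Fin n) :=
    LinearIsometryEquiv.piLpCongrRight 2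
      (fun k : Fin n => if k = i then LinearIsometryEquiv.neg ℝ else LinearIsometryEquiv.refl ℝ ℝ)
  have := e.measurePreserving.integral_comp e.toHomeomorph.measurableEmbedding
    (fun v : EuclideanSpace ℝ (Fin n) => v i * v j * g ‖v‖)
  have h2 : ∀ v : EuclideanSpace ℝ (Fin n),
      (e v) i * (e v) j * g ‖e v‖ = -(v i * v j * g ‖v‖) := by
    intro v
    have h1 : (e v) i = - v i := by
      simp [e, LinearIsometryEquiv.piLpCongrRight_apply]
    have h3 : (e v) j = v j := by
      simp [e, LinearIsometryEquiv.piLpCongrRight_apply, hij.symm]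
    rw [h1, h3, LinearIsometryEquiv.norm_map]; ring
  simp_rw [h2] at this
  rw [integral_neg] at this
  linarith

theorem stmt_14 (n : ℕ) (hn : 1 ≤ n) (σ : ℝ) (hσ : 0 < σ) :
    ∀ i j : Fin n,
      (∫ v : EuclideanSpace ℝ (Fin n),
          v i * v j * (1 - ‖v‖ ^ 2 / 6 + ‖v‖ ^ 4 / 120) *
            Real.exp (-‖v‖ ^ 2 / (2 * σ ^ 2))) =
        (if i = j then 1 else 0) * (2 * Real.pi) ^ ((n : ℝ) / 2) * σ ^ (n + 2) *
          (1 - ((n + 2 : ℝ) / 6) * σ ^ 2 + ((n + 2 : ℝ) * (n + 4) / 120) * σ ^ 4) := by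
  intro i j
  obtain ⟨b, hbdef⟩ : ∃ b : ℝ, b = 1 / (2 * σ ^ 2) := ⟨_, rfl⟩
  have hb : 0 < b := by rw [hbdef]; positivity
  let g : ℝ → ℝ := fun r => (1 - r ^ 2 / 6 + r ^ 4 / 120) * Real.exp (-b * r ^ 2)
  have hg : ∀ v : EuclideanSpace ℝ (Fin n), ∀ i j : Fin n,
      v i * v j * (1 - ‖v‖ ^ 2 / 6 + ‖v‖ ^ 4 / 120) *
            Real.exp (-‖v‖ ^ 2 / (2 * σ ^ 2)) = v i * v j * g ‖v‖ := by
    intro v i j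
    have : -‖v‖ ^ 2 / (2 * σ ^ 2) = -b * ‖v‖ ^ 2 := by rw [hbdef]; ring
    rw [this]; simp only [g]; ring
  simp_rw [hg]
  by_cases hij : i = j
  swap
  · rw [offdiag_zero g i j hij]; simp [hij]
  subst hij
  have hn' : (1 : ℝ) ≤ n := by exact_mod_cast hn
  have I2 := moment_integrable hn hb 2
  have I4 := moment_integrable hn hb 4
  have I6 := moment_integrable hn hb 6
  have M2 := moment_succ hn hb 0
  have M4 := moment_succ hn hb 2
  have M6 := moment_succ hn hb 4
  have M0 := GaussianFourier.integral_rexp_neg_mul_sq_norm (V := EuclideanSpace ℝ (Fin n)) hb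
  rw [finrank_euclideanSpace_fin] at M0
  have hsplit : (fun v : EuclideanSpace ℝ (Fin n) => ‖v‖ ^ 2 * g ‖v‖) = fun v =>
      (‖v‖ ^ 2 * Real.exp (-b * ‖v‖ ^ 2) - (1 / 6) * (‖v‖ ^ 4 * Real.exp (-b * ‖v‖ ^ 2)))
        + (1 / 120) * (‖v‖ ^ 6 * Real.exp (-b * ‖v‖ ^ 2)) := by
    ext v; simp only [g]; ring
  have Ig : Integrable (fun v : EuclideanSpace ℝ (Fin n) => ‖v‖ ^ 2 * g ‖v‖) := by
    rw [hsplit]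
    exact (I2.sub (I4.const_mul _)).add (I6.const_mul _)
  have hI : ∀ k : Fin n, Integrable (fun v : EuclideanSpace ℝ (Fin n) => v k * v k * g ‖v‖) := by
    intro k
    refine Ig.mono (Continuous.aestronglyMeasurable (by simp only [g]; fun_prop)) ?_
    refine Filter.Eventually.of_forall fun v => ?_
    rw [norm_mul _ (g ‖v‖), norm_mul _ (g ‖v‖), norm_mul, norm_pow, norm_norm]
    have := PiLp.norm_apply_le v k
    gcongr
    rw [← sq]
    gcongr
  have hsum : (n : ℝ) * ∫ v : EuclideanSpace ℝ (Fin n), v i * v i * g ‖v‖ =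
      ∫ v : EuclideanSpace ℝ (Fin n), ‖v‖ ^ 2 * g ‖v‖ := by
    have : ∀ v : EuclideanSpace ℝ (Fin n), ‖v‖ ^ 2 * g ‖v‖ = ∑ k, v k * v k * g ‖v‖ := by
      intro v
      rw [← Finset.sum_mul, EuclideanSpace.real_norm_sq_eq]
      simp_rw [sq]
    simp_rw [this]
    rw [integral_finsetSum _ (fun k _ => hI k)]
    simp_rw [fun k => diag_eq g k i]
    simp
  have I24 : Integrable (fun v : EuclideanSpace ℝ (Fin n) => ‖v‖ ^ 2 * Real.exp (-b * ‖v‖ ^ 2)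
      - (1 / 6) * (‖v‖ ^ 4 * Real.exp (-b * ‖v‖ ^ 2))) := I2.sub (I4.const_mul _)
  rw [hsplit, integral_add I24 (I6.const_mul _),
    integral_sub I2 (I4.const_mul _), integral_const_mul, integral_const_mul] at hsum
  norm_num [-neg_mul] at M2 M4 M6
  rw [M6, M4, M2, M0] at hsum
  have hpi : (π / b) ^ ((n : ℝ) / 2) = (2 * π) ^ ((n : ℝ) / 2) * σ ^ n := by
    have : π / b = (2 * π) * σ ^ 2 := by rw [hbdef]; field_simp
    rw [this, Real.mul_rpow (by positivity) (by positivity), ← Real.rpow_natCast σ 2,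
      ← Real.rpow_mul hσ.le, ← Real.rpow_natCast σ n]
    congr 2
    push_cast; ring
  have h2b : 2 * b = (σ ^ 2)⁻¹ := by rw [hbdef]; field_simp
  rw [hpi, h2b] at hsum
  have hn0 : (n : ℝ) ≠ 0 := by positivity
  apply mul_left_cancel₀ hn0
  rw [hsum]
  simp only [if_true, div_inv_eq_mul]
  ring
end

section
/- Let n ≥ 1 and σ > 0. Then for all indices i, j, ∫_{ℝⁿ} v_i v_j (1 + ‖v‖²/6 + ‖v‖⁴/120) exp(−‖v‖²/(2σ²)) dv = δ_{ij} (2π)^{n/2} σ^{n+2} (1 + ((n+2)/6)σ² + ((n+2)(n+4)/120)σ⁴), where δ_{ij} is the Kronecker delta. -/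
open MeasureTheory Real

lemma aux_intOn (n : ℕ) (hn : 1 ≤ n) (σ : ℝ) (hσ : 0 < σ) (m : ℕ) :
    IntegrableOn (fun y : ℝ => y ^ (n - 1) * (y ^ (2 * m) * Real.exp (-y ^ 2 / (2 * σ ^ 2))))
      (Set.Ioi 0) ∧
    ∫ y in Set.Ioi (0 : ℝ), y ^ (n - 1) * (y ^ (2 * m) * Real.exp (-y ^ 2 / (2 * σ ^ 2))) =
      2⁻¹ * ((2 * σ ^ 2) ^ ((n : ℝ) / 2) * (2 * σ ^ 2) ^ m) * Real.Gamma ((n : ℝ) / 2 + m) := by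
  have hb : 0 < (2 * σ ^ 2)⁻¹ := by positivity
  have hn' : (1 : ℝ) ≤ n := by exact_mod_cast hn
  have hq : (-1 : ℝ) < ((n - 1 + 2 * m : ℕ) : ℝ) := by
    have : (0 : ℝ) ≤ ((n - 1 + 2 * m : ℕ) : ℝ) := Nat.cast_nonneg _
    linarith
  have hE : (fun y : ℝ => y ^ (n - 1) * (y ^ (2 * m) * Real.exp (-y ^ 2 / (2 * σ ^ 2)))) =
      fun y : ℝ => y ^ (((n - 1 + 2 * m : ℕ) : ℝ)) * Real.exp (-(2 * σ ^ 2)⁻¹ * y ^ (2 : ℝ)) := by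
    funext y
    rw [Real.rpow_natCast, Real.rpow_two, pow_add, mul_assoc]
    congr 3
    field_simp
  rw [hE]
  refine ⟨integrableOn_rpow_mul_exp_neg_mul_rpow hq two_pos hb, ?_⟩
  rw [integral_rpow_mul_exp_neg_mul_rpow two_pos hq hb]
  have h1 : ((n - 1 + 2 * m : ℕ) : ℝ) + 1 = n + 2 * m := by
    push_cast [Nat.cast_sub hn]; ring
  have hc : 0 < 2 * σ ^ 2 := by positivity
  rw [neg_div, h1, Real.rpow_neg hb.le, Real.inv_rpow hc.le, inv_inv,
    show ((n : ℝ) + 2 * m) / 2 = n / 2 + m by ring, Real.rpow_add hc, Real.rpow_natCast]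
  ring

lemma aux_rad (n : ℕ) (hn : 1 ≤ n) (σ : ℝ) (hσ : 0 < σ) (m : ℕ) :
    Integrable (fun v : EuclideanSpace ℝ (Fin n) =>
      ‖v‖ ^ (2 * m) * Real.exp (-‖v‖ ^ 2 / (2 * σ ^ 2))) ∧
    ∫ v : EuclideanSpace ℝ (Fin n), ‖v‖ ^ (2 * m) * Real.exp (-‖v‖ ^ 2 / (2 * σ ^ 2)) =
      (2 * Real.pi) ^ ((n : ℝ) / 2) * σ ^ n * (2 * σ ^ 2) ^ m *
        (Real.Gamma ((n : ℝ) / 2 + m) / Real.Gamma ((n : ℝ) / 2)) := by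
  have : Nonempty (Fin n) := ⟨⟨0, hn⟩⟩
  have : Nontrivial (EuclideanSpace ℝ (Fin n)) := inferInstance
  obtain ⟨h1, h2⟩ := aux_intOn n hn σ hσ m
  constructor
  · apply (integrable_fun_norm_addHaar (volume : Measure (EuclideanSpace ℝ (Fin n)))
      (f := fun y : ℝ => y ^ (2 * m) * Real.exp (-y ^ 2 / (2 * σ ^ 2)))).2
    simpa using h1
  · have := integral_fun_norm_addHaar (volume : Measure (EuclideanSpace ℝ (Fin n)))
      (fun y : ℝ => y ^ (2 * m) * Real.exp (-y ^ 2 / (2 * σ ^ 2)))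
    rw [this]
    simp only [finrank_euclideanSpace, Fintype.card_fin, smul_eq_mul, nsmul_eq_mul]
    rw [h2, measureReal_def, EuclideanSpace.volume_ball]
    have hn' : (0 : ℝ) < n := by exact_mod_cast hn
    have hG := Real.Gamma_pos_of_pos (half_pos hn')
    have hp : √π ^ n = π ^ ((n : ℝ) / 2) := by
      rw [Real.sqrt_eq_rpow, ← Real.rpow_natCast, ← Real.rpow_mul Real.pi_pos.le]
      congr 1; ring
    have hs : (σ ^ 2) ^ ((n : ℝ) / 2) = σ ^ n := by
      rw [← Real.rpow_natCast, ← Real.rpow_natCast, ← Real.rpow_mul hσ.le]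
      congr 1; push_cast; ring
    simp only [ENNReal.ofReal_one, one_pow, one_mul, Fintype.card_fin]
    rw [ENNReal.toReal_ofReal (by positivity), Real.Gamma_add_one (by positivity), hp,
      Real.mul_rpow (by norm_num) (by positivity), hs,
      Real.mul_rpow (by norm_num) Real.pi_pos.le]
    field_simp

theorem stmt_16 (n : ℕ) (hn : 1 ≤ n) (σ : ℝ) (hσ : 0 < σ) :
    ∀ i j : Fin n,
      (∫ v : EuclideanSpace ℝ (Fin n),
          v i * v j * (1 + ‖v‖ ^ 2 / 6 + ‖v‖ ^ 4 / 120) *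
            Real.exp (-‖v‖ ^ 2 / (2 * σ ^ 2))) =
        (if i = j then 1 else 0) * (2 * Real.pi) ^ ((n : ℝ) / 2) * σ ^ (n + 2) *
          (1 + ((n + 2 : ℝ) / 6) * σ ^ 2 + ((n + 2 : ℝ) * (n + 4) / 120) * σ ^ 4) := by
  intro i j
  by_cases hij : i = j
  · subst hij
    have hn' : (0 : ℝ) < n := by exact_mod_cast hn
    have hG := Real.Gamma_pos_of_pos (half_pos hn')
    set F : EuclideanSpace ℝ (Fin n) → ℝ := fun v =>
      (1 + ‖v‖ ^ 2 / 6 + ‖v‖ ^ 4 / 120) * Real.exp (-‖v‖ ^ 2 / (2 * σ ^ 2)) with hF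
    obtain ⟨i1, e1⟩ := aux_rad n hn σ hσ 1
    obtain ⟨i2, e2⟩ := aux_rad n hn σ hσ 2
    obtain ⟨i3, e3⟩ := aux_rad n hn σ hσ 3
    have hN : (fun v : EuclideanSpace ℝ (Fin n) => ‖v‖ ^ 2 * F v) = fun v =>
        (‖v‖ ^ (2 * 1) * Real.exp (-‖v‖ ^ 2 / (2 * σ ^ 2)) +
        1 / 6 * (‖v‖ ^ (2 * 2) * Real.exp (-‖v‖ ^ 2 / (2 * σ ^ 2)))) +
        1 / 120 * (‖v‖ ^ (2 * 3) * Real.exp (-‖v‖ ^ 2 / (2 * σ ^ 2))) := by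
      funext v; simp only [hF]; ring
    have hNi : Integrable (fun v : EuclideanSpace ℝ (Fin n) => ‖v‖ ^ 2 * F v) := by
      rw [hN]
      exact (i1.add (i2.const_mul _)).add (i3.const_mul _)
    have hNe : ∫ v : EuclideanSpace ℝ (Fin n), ‖v‖ ^ 2 * F v =
        n * ((2 * Real.pi) ^ ((n : ℝ) / 2) * σ ^ (n + 2) *
          (1 + ((n + 2 : ℝ) / 6) * σ ^ 2 + ((n + 2 : ℝ) * (n + 4) / 120) * σ ^ 4)) := by
      rw [hN, integral_add (by exact i1.add (i2.const_mul _)) (i3.const_mul _),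
        integral_add i1 (i2.const_mul _), integral_const_mul, integral_const_mul, e1, e2, e3]
      have g1 : Real.Gamma ((n : ℝ) / 2 + (1 : ℕ)) = n / 2 * Real.Gamma ((n : ℝ) / 2) := by
        rw [Nat.cast_one, Real.Gamma_add_one (by positivity)]
      have g2 : Real.Gamma ((n : ℝ) / 2 + (2 : ℕ)) =
          (n / 2 + 1) * (n / 2 * Real.Gamma ((n : ℝ) / 2)) := by
        rw [← g1, Nat.cast_one, ← Real.Gamma_add_one (by positivity)]
        congr 1; push_cast; ring
      have g3 : Real.Gamma ((n : ℝ) / 2 + (3 : ℕ)) =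
          (n / 2 + 2) * ((n / 2 + 1) * (n / 2 * Real.Gamma ((n : ℝ) / 2))) := by
        rw [← g2, Nat.cast_ofNat, Nat.cast_ofNat, ← Real.Gamma_add_one (by positivity)]
        congr 1; push_cast; ring
      rw [g1, g2, g3]
      field_simp
      ring
    have hsym : ∀ k : Fin n, ∫ v : EuclideanSpace ℝ (Fin n), v k ^ 2 * F v =
        ∫ v : EuclideanSpace ℝ (Fin n), v i ^ 2 * F v := by
      intro k
      let e := LinearIsometryEquiv.piLpCongrLeft 2 ℝ ℝ (Equiv.swap i k)
      rw [← (e.measurePreserving).integral_comp e.toHomeomorph.measurableEmbedding]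
      congr 1
      funext v
      simp only [hF, LinearIsometryEquiv.norm_map]
      simp [e, LinearIsometryEquiv.piLpCongrLeft_apply, Equiv.piCongrLeft'_apply]
    have hki : ∀ k : Fin n, Integrable (fun v : EuclideanSpace ℝ (Fin n) => v k ^ 2 * F v) := by
      intro k
      refine hNi.mono' (by simp only [hF]; fun_prop) (Filter.Eventually.of_forall fun v => ?_)
      have hF0 : 0 ≤ F v := by simp only [hF]; positivity
      rw [Real.norm_of_nonneg (by positivity)]
      have := PiLp.norm_apply_le v k
      rw [Real.norm_eq_abs] at this
      have h2 : v k ^ 2 ≤ ‖v‖ ^ 2 := sq_le_sq' (by linarith [neg_abs_le (v k)])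
        (by linarith [le_abs_self (v k)])
      gcongr
    have hsum : ∫ v : EuclideanSpace ℝ (Fin n), ‖v‖ ^ 2 * F v =
        n * ∫ v : EuclideanSpace ℝ (Fin n), v i ^ 2 * F v := by
      have : (fun v : EuclideanSpace ℝ (Fin n) => ‖v‖ ^ 2 * F v) =
          fun v => ∑ k, v k ^ 2 * F v := by
        funext v
        rw [← Finset.sum_mul, EuclideanSpace.real_norm_sq_eq]
      rw [this, integral_finsetSum _ (fun k _ => hki k), Finset.sum_congr rfl (fun k _ => hsym k)]
      simp
    rw [hNe] at hsum
    have := mul_left_cancel₀ hn'.ne' hsum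
    rw [if_pos rfl, one_mul, this]
    congr 1
    funext v
    simp only [hF]; ring
  · rw [if_neg hij]
    simp only [zero_mul]
    let e := LinearIsometryEquiv.piLpCongrRight 2 (𝕜 := ℝ) (α := fun _ : Fin n => ℝ)
      (β := fun _ : Fin n => ℝ)
      (fun k => if k = i then LinearIsometryEquiv.neg ℝ else LinearIsometryEquiv.refl ℝ ℝ)
    have h := (e.measurePreserving).integral_comp e.toHomeomorph.measurableEmbedding
      (fun v : EuclideanSpace ℝ (Fin n) => v i * v j * (1 + ‖v‖ ^ 2 / 6 + ‖v‖ ^ 4 / 120) *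
            Real.exp (-‖v‖ ^ 2 / (2 * σ ^ 2)))
    have hei : ∀ v, e v i = - v i := by intro v; simp [e]
    have hej : ∀ v, e v j = v j := by intro v; simp [e, Ne.symm hij]
    simp only [LinearIsometryEquiv.norm_map, hei, hej, neg_mul] at h
    rw [integral_neg] at h
    linarith
end
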